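/- Let k ≥ 1 and let q be a real polynomial in two variables of total degree at most k−1 that vanishes at the three vertices (0,0), (1,0), (0,1) of the reference triangle and satisfies ∫_{T̂} q dx dy = 0. Then there exists a pair of polynomials v = (v₁,v₂), each of total degree at most k, such that v vanishes at every point of ∂T̂ and ∂₁v₁ + ∂₂v₂ = q identically. In other words, div B^k(T̂) = M^{k−1}(T̂). -/

import Mathlib

open MvPolynomial MeasureTheory

/-- The reference triangle `T̂ = {(x,y) : x ≥ 0, y ≥ 0, x + y ≤ 1}`. -/
def Tref : Set (ℝ × ℝ) := {p | 0 ≤ p.1 ∧ 0 ≤ p.2 ∧ p.1 + p.2 ≤ 1}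

/-- `(x,y)` lies on the boundary of the reference triangle. -/
def OnBdryT (x y : ℝ) : Prop :=
  0 ≤ x ∧ 0 ≤ y ∧ x + y ≤ 1 ∧ (x = 0 ∨ y = 0 ∨ x + y = 1)

/-- The cubic bubble `x y (1 - x - y)` of the reference triangle. -/
noncomputable def bubble : MvPolynomial (Fin 2) ℝ := X 0 * X 1 * (1 - X 0 - X 1)

/-- The multiples of the bubble function of total degree at most `k`. -/
noncomputable def bubbleMultiples (k : ℕ) : Submodule ℝ (MvPolynomial (Fin 2) ℝ) :=
  restrictTotalDegree (Fin 2) ℝ k ⊓ (Ideal.span {bubble}).restrictScalars ℝ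

/-- The divergences of fields of bubble multiples, enlarged by the span of `1, x, y, xy`. -/
noncomputable def divAddBilinear (k : ℕ) : Submodule ℝ (MvPolynomial (Fin 2) ℝ) :=
  ((bubbleMultiples k).map (pderiv (0 : Fin 2)).toLinearMap ⊔
    (bubbleMultiples k).map (pderiv (1 : Fin 2)).toLinearMap) ⊔
  Submodule.span ℝ {1, X 0, X 1, X 0 * X 1}

lemma mem_bubbleMultiples {k : ℕ} {v : MvPolynomial (Fin 2) ℝ} :
    v ∈ bubbleMultiples k ↔ v.totalDegree ≤ k ∧ ∃ w, v = bubble * w := by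
  simp only [bubbleMultiples, Submodule.mem_inf, mem_restrictTotalDegree,
    Submodule.restrictScalars_mem, Ideal.mem_span_singleton, Dvd.dvd]

lemma totalDegree_bubble_le : bubble.totalDegree ≤ 3 := by
  have hlin : (1 - X 0 - X 1 : MvPolynomial (Fin 2) ℝ).totalDegree ≤ 1 := by
    refine (totalDegree_sub _ _).trans (max_le ((totalDegree_sub _ _).trans (max_le ?_ ?_)) ?_) <;>
      simp
  have hmul : (X 0 * X 1 : MvPolynomial (Fin 2) ℝ).totalDegree ≤ 2 :=
    (totalDegree_mul _ _).trans (by simp)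
  exact (totalDegree_mul _ _).trans (by omega)

lemma bubble_mul_monomial_mem {k i j : ℕ} (h : i + j + 3 ≤ k) :
    bubble * (X 0 ^ i * X 1 ^ j) ∈ bubbleMultiples k := by
  refine mem_bubbleMultiples.2 ⟨?_, _, rfl⟩
  have hmul : (X 0 ^ i * X 1 ^ j : MvPolynomial (Fin 2) ℝ).totalDegree ≤ i + j :=
    (totalDegree_mul _ _).trans (by simp)
  have hb := totalDegree_bubble_le
  exact (totalDegree_mul _ _).trans (by omega)

lemma pderiv_zero_bubble_mul_monomial_mem {k i j : ℕ} (h : i + j + 3 ≤ k) :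
    ((i + 1 : ℝ) • (X 0 ^ i * X 1 ^ (j + 1)) - (i + 2 : ℝ) • (X 0 ^ (i + 1) * X 1 ^ (j + 1))
      - (i + 1 : ℝ) • (X 0 ^ i * X 1 ^ (j + 2)) : MvPolynomial (Fin 2) ℝ) ∈
      divAddBilinear k := by
  refine Submodule.mem_sup_left (Submodule.mem_sup_left
    ⟨bubble * (X 0 ^ i * X 1 ^ j), bubble_mul_monomial_mem h, ?_⟩)
  have hb : bubble * (X 0 ^ i * X 1 ^ j) =
      X 0 ^ (i + 1) * X 1 ^ (j + 1) - X 0 ^ (i + 2) * X 1 ^ (j + 1)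
        - X 0 ^ (i + 1) * X 1 ^ (j + 2) := by
    rw [bubble]; ring
  rw [hb]
  simp [pderiv_X, smul_eq_C_mul]
  rw [show (C 2 : MvPolynomial (Fin 2) ℝ) = 2 from map_ofNat C 2]
  ring

lemma pderiv_one_bubble_mul_monomial_mem {k i j : ℕ} (h : i + j + 3 ≤ k) :
    ((j + 1 : ℝ) • (X 0 ^ (i + 1) * X 1 ^ j) - (j + 1 : ℝ) • (X 0 ^ (i + 2) * X 1 ^ j)
      - (j + 2 : ℝ) • (X 0 ^ (i + 1) * X 1 ^ (j + 1)) : MvPolynomial (Fin 2) ℝ) ∈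
      divAddBilinear k := by
  refine Submodule.mem_sup_left (Submodule.mem_sup_right
    ⟨bubble * (X 0 ^ i * X 1 ^ j), bubble_mul_monomial_mem h, ?_⟩)
  have hb : bubble * (X 0 ^ i * X 1 ^ j) =
      X 0 ^ (i + 1) * X 1 ^ (j + 1) - X 0 ^ (i + 2) * X 1 ^ (j + 1)
        - X 0 ^ (i + 1) * X 1 ^ (j + 2) := by
    rw [bubble]; ring
  rw [hb]
  simp [pderiv_X, smul_eq_C_mul]
  rw [show (C 2 : MvPolynomial (Fin 2) ℝ) = 2 from map_ofNat C 2]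
  ring

lemma X_zero_mul_X_one_pow_mem {k b : ℕ} (h : b + 3 ≤ k) :
    (X 0 ^ 1 * X 1 ^ (b + 1) : MvPolynomial (Fin 2) ℝ) ∈ divAddBilinear k := by
  induction b with
  | zero => exact Submodule.mem_sup_right (Submodule.subset_span (by simp))
  | succ d ih =>
    have h₁ := pderiv_zero_bubble_mul_monomial_mem (k := k) (i := 1) (j := d) (by omega)
    have h₂ := pderiv_one_bubble_mul_monomial_mem (k := k) (i := 0) (j := d + 1) (by omega)
    have hne : (d + 5 : ℝ) ≠ 0 := by positivity
    refine (Submodule.smul_mem_iff _ hne).1 ?_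
    convert Submodule.add_mem _ (Submodule.smul_mem _ (d + 2 : ℝ) (ih (by omega)))
      (Submodule.sub_mem _ (Submodule.smul_mem _ (d + 2 : ℝ) h₁)
        (Submodule.smul_mem _ (3 : ℝ) h₂)) using 1
    push_cast
    module

lemma interior_monomial_mem {k a b : ℕ} (h : a + b + 3 ≤ k) :
    (X 0 ^ (a + 1) * X 1 ^ (b + 1) : MvPolynomial (Fin 2) ℝ) ∈ divAddBilinear k := by
  induction a generalizing b with
  | zero => exact X_zero_mul_X_one_pow_mem (by omega)
  | succ a ih =>
    have h₁ := pderiv_zero_bubble_mul_monomial_mem (k := k) (i := a + 1) (j := b) (by omega)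
    have hne : (a + 3 : ℝ) ≠ 0 := by positivity
    refine (Submodule.smul_mem_iff _ hne).1 ?_
    convert Submodule.sub_mem _ (Submodule.sub_mem _
      (Submodule.smul_mem _ (a + 2 : ℝ) (ih (b := b) (by omega)))
      (Submodule.smul_mem _ (a + 2 : ℝ) (ih (b := b + 1) (by omega)))) h₁ using 1
    push_cast
    module

lemma X_zero_pow_mem {k a : ℕ} (h : a + 1 ≤ k) :
    (X 0 ^ a * X 1 ^ 0 : MvPolynomial (Fin 2) ℝ) ∈ divAddBilinear k := by
  induction a with
  | zero => exact Submodule.mem_sup_right (Submodule.subset_span (by simp))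
  | succ a ih =>
    rcases a with _ | a
    · exact Submodule.mem_sup_right (Submodule.subset_span (by simp))
    · have h₂ := pderiv_one_bubble_mul_monomial_mem (k := k) (i := a) (j := 0) (by omega)
      convert Submodule.sub_mem _ (Submodule.sub_mem _ (ih (by omega))
        (Submodule.smul_mem _ (2 : ℝ) (interior_monomial_mem (k := k) (a := a) (b := 0)
          (by omega)))) h₂ using 1
      push_cast
      module

lemma X_one_pow_mem {k b : ℕ} (h : b + 1 ≤ k) :
    (X 0 ^ 0 * X 1 ^ b : MvPolynomial (Fin 2) ℝ) ∈ divAddBilinear k := by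
  induction b with
  | zero => exact Submodule.mem_sup_right (Submodule.subset_span (by simp))
  | succ b ih =>
    rcases b with _ | b
    · exact Submodule.mem_sup_right (Submodule.subset_span (by simp))
    · have h₁ := pderiv_zero_bubble_mul_monomial_mem (k := k) (i := 0) (j := b) (by omega)
      convert Submodule.sub_mem _ (Submodule.sub_mem _ (ih (by omega))
        (Submodule.smul_mem _ (2 : ℝ) (interior_monomial_mem (k := k) (a := 0) (b := b)
          (by omega)))) h₁ using 1
      push_cast
      module

lemma monomial_mem_divAddBilinear {k a b : ℕ} (h : a + b + 1 ≤ k) :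
    (X 0 ^ a * X 1 ^ b : MvPolynomial (Fin 2) ℝ) ∈ divAddBilinear k := by
  rcases a with _ | a
  · exact X_one_pow_mem (by omega)
  rcases b with _ | b
  · exact X_zero_pow_mem (by omega)
  exact interior_monomial_mem (by omega)

lemma mem_divAddBilinear {k : ℕ} (hk : 1 ≤ k) {q : MvPolynomial (Fin 2) ℝ}
    (hq : q.totalDegree ≤ k - 1) : q ∈ divAddBilinear k := by
  rw [q.as_sum]
  refine Submodule.sum_mem _ fun s hs ↦ ?_
  have hdeg := (le_totalDegree hs).trans hq
  rw [Finsupp.sum_fintype _ _ (fun _ ↦ rfl), Fin.sum_univ_two] at hdeg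
  rw [monomial_eq, Finsupp.prod_fintype _ _ (fun _ ↦ pow_zero _), Fin.prod_univ_two,
    ← smul_eq_C_mul]
  exact Submodule.smul_mem _ _ (monomial_mem_divAddBilinear (by omega))

lemma bubble_eval_eq_zero {x y : ℝ} (h : x = 0 ∨ y = 0 ∨ x + y = 1) :
    eval ![x, y] bubble = 0 := by
  rcases h with h | h | h
  · simp [bubble, h]
  · simp [bubble, h]
  · have : 1 - x - y = 0 := by linarith
    simp [bubble, this]

lemma continuous_eval_prod (p : MvPolynomial (Fin 2) ℝ) :
    Continuous fun z : ℝ × ℝ ↦ eval ![z.1, z.2] p := by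
  refine (continuous_eval p).comp (continuous_pi fun i ↦ ?_)
  fin_cases i
  · exact continuous_fst
  · exact continuous_snd

lemma hasDerivAt_eval_fst (p : MvPolynomial (Fin 2) ℝ) (x y : ℝ) :
    HasDerivAt (fun t ↦ eval ![t, y] p) (eval ![x, y] (pderiv 0 p)) x := by
  induction p using MvPolynomial.induction_on with
  | C a => simpa using hasDerivAt_const x a
  | add p q hp hq => simpa using hp.fun_add hq
  | mul_X p i hp =>
    fin_cases i
    · simpa [pderiv_X, mul_comm, add_comm] using hp.fun_mul (hasDerivAt_id x)
    · simpa [pderiv_X, mul_comm] using hp.mul_const y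

lemma hasDerivAt_eval_snd (p : MvPolynomial (Fin 2) ℝ) (x y : ℝ) :
    HasDerivAt (fun t ↦ eval ![x, t] p) (eval ![x, y] (pderiv 1 p)) y := by
  induction p using MvPolynomial.induction_on with
  | C a => simpa using hasDerivAt_const y a
  | add p q hp hq => simpa using hp.fun_add hq
  | mul_X p i hp =>
    fin_cases i
    · simpa [pderiv_X, mul_comm] using hp.mul_const x
    · simpa [pderiv_X, mul_comm, add_comm] using hp.fun_mul (hasDerivAt_id y)

lemma continuous_eval_fst (p : MvPolynomial (Fin 2) ℝ) (y : ℝ) :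
    Continuous fun x ↦ eval ![x, y] p :=
  continuous_iff_continuousAt.2 fun x ↦ (hasDerivAt_eval_fst p x y).continuousAt

lemma continuous_eval_snd (p : MvPolynomial (Fin 2) ℝ) (x : ℝ) :
    Continuous fun y ↦ eval ![x, y] p :=
  continuous_iff_continuousAt.2 fun y ↦ (hasDerivAt_eval_snd p x y).continuousAt

lemma isCompact_Tref : IsCompact Tref := by
  refine (isCompact_Icc (a := ((0 : ℝ), (0 : ℝ))) (b := (1, 1))).of_isClosed_subset ?_ ?_
  · exact (isClosed_le continuous_const continuous_fst).inter
      ((isClosed_le continuous_const continuous_snd).inter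
        (isClosed_le (continuous_fst.add continuous_snd) continuous_const))
  · rintro ⟨x, y⟩ ⟨hx, hy, hxy⟩
    simp only at hx hy hxy
    exact ⟨⟨hx, hy⟩, ⟨by simp only; linarith, by simp only; linarith⟩⟩

lemma integrableOn_eval (p : MvPolynomial (Fin 2) ℝ) :
    IntegrableOn (fun z : ℝ × ℝ ↦ eval ![z.1, z.2] p) Tref :=
  (continuous_eval_prod p).continuousOn.integrableOn_compact isCompact_Tref

lemma integral_indicator_Icc_eq_zero {f f' : ℝ → ℝ} (hf : ∀ t, HasDerivAt f (f' t) t)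
    (hf' : Continuous f') {a b : ℝ} (hab : a ≤ b) (ha : f a = 0) (hb : f b = 0) :
    ∫ t, (Set.Icc a b).indicator f' t = 0 := by
  rw [integral_indicator measurableSet_Icc, integral_Icc_eq_integral_Ioc,
    ← intervalIntegral.integral_of_le hab,
    intervalIntegral.integral_eq_sub_of_hasDerivAt (fun t _ ↦ hf t)
      (hf'.intervalIntegrable _ _), ha, hb, sub_zero]

lemma integral_pderiv_one_eq_zero {p : MvPolynomial (Fin 2) ℝ}
    (hp : ∀ x y, OnBdryT x y → eval ![x, y] p = 0) :
    ∫ z in Tref, eval ![z.1, z.2] (pderiv 1 p) = 0 := by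
  rw [← integral_indicator isCompact_Tref.measurableSet, Measure.volume_eq_prod, integral_prod]
  · refine integral_eq_zero_of_ae (Filter.Eventually.of_forall fun x ↦ ?_)
    by_cases hx : 0 ≤ x ∧ x ≤ 1
    · have hz := integral_indicator_Icc_eq_zero (hasDerivAt_eval_snd p x)
        (continuous_eval_snd (pderiv 1 p) x)
        (sub_nonneg.2 hx.2)
        (hp _ _ (by simp [OnBdryT, hx]))
        (hp _ _ (by simp [OnBdryT, hx]))
      simp only [Pi.zero_apply]
      rw [← hz]
      congr 1 with y
      simp only [Set.indicator, Tref, Set.mem_ofPred_eq, Set.mem_Icc]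
      congr 1
      simp only [hx.1, true_and, eq_iff_iff]
      constructor <;> rintro ⟨h₁, h₂⟩ <;> constructor <;> linarith
    · simp only [Pi.zero_apply]
      refine integral_eq_zero_of_ae (Filter.Eventually.of_forall fun y ↦ ?_)
      refine Set.indicator_of_notMem (fun hmem ↦ hx ?_) _
      obtain ⟨h₁, h₂, h₃⟩ : 0 ≤ x ∧ 0 ≤ y ∧ x + y ≤ 1 := hmem
      exact ⟨h₁, by linarith⟩
  · rw [← Measure.volume_eq_prod]
    exact (integrableOn_eval _).integrable_indicator isCompact_Tref.measurableSet

lemma integral_pderiv_zero_eq_zero {p : MvPolynomial (Fin 2) ℝ}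
    (hp : ∀ x y, OnBdryT x y → eval ![x, y] p = 0) :
    ∫ z in Tref, eval ![z.1, z.2] (pderiv 0 p) = 0 := by
  rw [← integral_indicator isCompact_Tref.measurableSet, Measure.volume_eq_prod,
    integral_prod_symm]
  · refine integral_eq_zero_of_ae (Filter.Eventually.of_forall fun y ↦ ?_)
    by_cases hy : 0 ≤ y ∧ y ≤ 1
    · have hz := integral_indicator_Icc_eq_zero
        (fun x ↦ hasDerivAt_eval_fst p x y)
        (continuous_eval_fst (pderiv 0 p) y)
        (sub_nonneg.2 hy.2)
        (hp _ _ (by simp [OnBdryT, hy]))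
        (hp _ _ (by simp [OnBdryT, hy]))
      simp only [Pi.zero_apply]
      rw [← hz]
      congr 1 with x
      simp only [Set.indicator, Tref, Set.mem_ofPred_eq, Set.mem_Icc]
      congr 1
      simp only [hy.1, true_and, eq_iff_iff]
      constructor <;> rintro ⟨h₁, h₂⟩ <;> constructor <;> linarith
    · simp only [Pi.zero_apply]
      refine integral_eq_zero_of_ae (Filter.Eventually.of_forall fun x ↦ ?_)
      refine Set.indicator_of_notMem (fun hmem ↦ hy ?_) _
      obtain ⟨h₁, h₂, h₃⟩ : 0 ≤ x ∧ 0 ≤ y ∧ x + y ≤ 1 := hmem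
      exact ⟨h₂, by linarith⟩
  · rw [← Measure.volume_eq_prod]
    exact (integrableOn_eval _).integrable_indicator isCompact_Tref.measurableSet

lemma integral_mul_Tref_pos : 0 < ∫ z in Tref, z.1 * z.2 := by
  have hint : IntegrableOn (fun z : ℝ × ℝ ↦ z.1 * z.2) Tref :=
    (continuous_fst.mul continuous_snd).continuousOn.integrableOn_compact isCompact_Tref
  rw [setIntegral_pos_iff_support_of_nonneg_ae _ hint]
  · have hopen : IsOpen (Set.Ioo (0 : ℝ) (1 / 2) ×ˢ Set.Ioo (0 : ℝ) (1 / 2)) :=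
      isOpen_Ioo.prod isOpen_Ioo
    refine (hopen.measure_pos volume ⟨(1 / 4, 1 / 4), by norm_num⟩).trans_le
      (measure_mono ?_)
    rintro ⟨x, y⟩ ⟨⟨hx, hx'⟩, hy, hy'⟩
    simp only at hx hx' hy hy'
    exact ⟨(mul_pos hx hy).ne', hx.le, hy.le, by simp only; linarith⟩
  · refine (ae_restrict_iff' isCompact_Tref.measurableSet).2 (Filter.Eventually.of_forall ?_)
    exact fun z hz ↦ mul_nonneg hz.1 hz.2.1

/-- Let `k ≥ 1` and let `q` be a polynomial of total degree at most `k − 1` vanishing at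
the three vertices `(0,0)`, `(1,0)`, `(0,1)` of the reference triangle and with zero
integral over it.  Then there is a pair of polynomials `v = (v₁,v₂)` of total degree at
most `k`, vanishing at every point of `∂T̂`, with `∂₁v₁ + ∂₂v₂ = q` identically.
In other words, `div B^k(T̂) = M^{k−1}(T̂)`. -/
theorem div_Bspace_eq_Mspace (k : ℕ) (hk : 1 ≤ k) (q : MvPolynomial (Fin 2) ℝ)
    (hq : q.totalDegree ≤ k - 1)
    (hq00 : eval ![0, 0] q = 0) (hq10 : eval ![1, 0] q = 0) (hq01 : eval ![0, 1] q = 0)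
    (hqint : (∫ p in Tref, eval ![p.1, p.2] q) = 0) :
    ∃ v₁ v₂ : MvPolynomial (Fin 2) ℝ,
      v₁.totalDegree ≤ k ∧ v₂.totalDegree ≤ k ∧
      (∀ x y : ℝ, OnBdryT x y → eval ![x, y] v₁ = 0 ∧ eval ![x, y] v₂ = 0) ∧
      pderiv (0 : Fin 2) v₁ + pderiv (1 : Fin 2) v₂ = q := by
  obtain ⟨d, hd, r, hr, rfl⟩ := Submodule.mem_sup.1 (mem_divAddBilinear hk hq)
  obtain ⟨_, ⟨v₁, hv₁, rfl⟩, _, ⟨v₂, hv₂, rfl⟩, rfl⟩ := Submodule.mem_sup.1 hd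
  obtain ⟨hdeg₁, w₁, rfl⟩ := mem_bubbleMultiples.1 hv₁
  obtain ⟨hdeg₂, w₂, rfl⟩ := mem_bubbleMultiples.1 hv₂
  simp only [Submodule.mem_span_insert, Submodule.mem_span_singleton] at hr
  obtain ⟨c₀, _, ⟨c₁, _, ⟨c₂, _, ⟨c₃, rfl⟩, rfl⟩, rfl⟩, rfl⟩ := hr
  simp only [Derivation.coeFn_coe] at *
  have h₀ : c₀ = 0 := by
    simpa [bubble, pderiv_mul, pderiv_X, smul_eq_C_mul] using hq00
  have h₁ : c₁ = 0 := by
    simpa [bubble, pderiv_mul, pderiv_X, smul_eq_C_mul, h₀] using hq10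
  have h₂ : c₂ = 0 := by
    simpa [bubble, pderiv_mul, pderiv_X, smul_eq_C_mul, h₀] using hq01
  subst h₀ h₁ h₂
  have hbdry (w : MvPolynomial (Fin 2) ℝ) (x y : ℝ) (h : OnBdryT x y) :
      eval ![x, y] (bubble * w) = 0 := by
    rw [map_mul, bubble_eval_eq_zero h.2.2.2, zero_mul]
  have h₃ : c₃ = 0 := by
    simp only [zero_smul, zero_add, map_add] at hqint
    rw [integral_add ((integrableOn_eval _).fun_add (integrableOn_eval _)) (integrableOn_eval _),
      integral_add (integrableOn_eval _) (integrableOn_eval _),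
      integral_pderiv_zero_eq_zero (hbdry w₁), integral_pderiv_one_eq_zero (hbdry w₂)] at hqint
    simp only [smul_eq_C_mul, map_mul, eval_C, eval_X, integral_const_mul, zero_add,
      Matrix.cons_val_zero, Matrix.cons_val_one, mul_eq_zero] at hqint
    exact hqint.resolve_right integral_mul_Tref_pos.ne'
  subst h₃
  exact ⟨bubble * w₁, bubble * w₂, hdeg₁, hdeg₂,
    fun x y h ↦ ⟨hbdry w₁ x y h, hbdry w₂ x y h⟩, by simp⟩
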